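/- arXiv:2508.04359 — 4 statements merged into one kernel-verified Lean document; each statement's English description precedes it below -/
import Mathlib

section
/- Let n ≥ 0 be an integer and let q, a, b, λ be complex numbers with 0 < |q| < 1, a ≠ 0, b ≠ 0, and 1 + a q^k ≠ 0 and 1 + b q^k ≠ 0 for all 1 ≤ k ≤ n. Then ∑_{m=0}^{n} [n choose m]_q · (-λ/a;q)_m a^m q^{m(m+1)/2} / (-bq;q)_m = [ (-aq;q)_n / (-bq;q)_n ] · ∑_{m=0}^{n} [n choose m]_q · (-λ/b;q)_m b^m q^{m(m+1)/2} / (-aq;q)_m. -/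
open scoped BigOperators

/-- The finite q-Pochhammer symbol `(a;q)_n`. -/
noncomputable def qPoch (a q : ℂ) (n : ℕ) : ℂ := ∏ k ∈ Finset.range n, (1 - a * q ^ k)

/-- The Gaussian binomial coefficient `[N choose n]_q`. -/
noncomputable def qbinom (q : ℂ) (N n : ℕ) : ℂ :=
  if n ≤ N then qPoch q q N / (qPoch q q n * qPoch q q (N - n)) else 0

lemma qPoch_succ (a q : ℂ) (n : ℕ) : qPoch a q (n + 1) = qPoch a q n * (1 - a * q ^ n) :=
  Finset.prod_range_succ _ _

lemma qPoch_add (a q : ℂ) (m n : ℕ) :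
    qPoch a q (m + n) = qPoch a q m * qPoch (a * q ^ m) q n := by
  simp only [qPoch, Finset.prod_range_add, pow_add, mul_assoc]

lemma qPoch_self_ne_zero {q : ℂ} (hq : ‖q‖ < 1) (n : ℕ) : qPoch q q n ≠ 0 := by
  refine Finset.prod_ne_zero_iff.2 fun k _ h => ?_
  have h1 : q ^ (k + 1) = 1 := by rw [pow_succ']; exact (sub_eq_zero.1 h).symm
  have h2 : ‖q‖ ^ (k + 1) < 1 := pow_lt_one₀ (norm_nonneg q) hq k.succ_ne_zero
  rw [← norm_pow, h1, norm_one] at h2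
  exact lt_irrefl _ h2

lemma qPoch_neg_mul_ne_zero {q a : ℂ} {n : ℕ}
    (h : ∀ k : ℕ, 1 ≤ k → k ≤ n → 1 + a * q ^ k ≠ 0) {m : ℕ} (hm : m ≤ n) :
    qPoch (-(a * q)) q m ≠ 0 := by
  refine Finset.prod_ne_zero_iff.2 fun k hk => ?_
  have hk' := Finset.mem_range.1 hk
  convert h (k + 1) (by omega) (by omega) using 1
  ring

lemma qPoch_div_mul_pow {a : ℂ} (ha : a ≠ 0) (lam q : ℂ) (m : ℕ) :
    qPoch (-lam / a) q m * a ^ m = ∏ k ∈ Finset.range m, (a + lam * q ^ k) := by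
  induction m with
  | zero => simp [qPoch]
  | succ m ih =>
    rw [Finset.prod_range_succ, ← ih, qPoch_succ]
    field_simp
    ring

lemma qbinom_add (q : ℂ) (m n : ℕ) :
    qbinom q (m + n) m = qPoch q q (m + n) / (qPoch q q m * qPoch q q n) := by
  simp [qbinom]

lemma qbinom_eq_zero (q : ℂ) {N n : ℕ} (h : N < n) : qbinom q N n = 0 :=
  if_neg h.not_ge

lemma qbinom_zero {q : ℂ} (hq : ‖q‖ < 1) (n : ℕ) : qbinom q n 0 = 1 := by
  have := qPoch_self_ne_zero hq n
  simp [qbinom, qPoch] at this ⊢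
  exact this

lemma qbinom_self {q : ℂ} (hq : ‖q‖ < 1) (n : ℕ) : qbinom q n n = 1 := by
  have := qPoch_self_ne_zero hq n
  simp [qbinom, qPoch] at this ⊢
  exact this

lemma qbinom_succ_succ {q : ℂ} (hq : ‖q‖ < 1) {n j : ℕ} (hj : j ≤ n) :
    qbinom q (n + 1) (j + 1) = qbinom q n (j + 1) + q ^ (n - j) * qbinom q n j := by
  obtain ⟨d, rfl⟩ := Nat.exists_eq_add_of_le hj
  cases d with
  | zero => simp [qbinom_self hq, qbinom_eq_zero]
  | succ d =>
    have e1 := qbinom_add q (j + 1) (d + 1)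
    have e2 := qbinom_add q (j + 1) d
    have e3 := qbinom_add q j (d + 1)
    rw [show j + 1 + (d + 1) = j + (d + 1) + 1 by ring] at e1
    rw [show j + 1 + d = j + (d + 1) by ring] at e2
    rw [e1, e2, e3, Nat.add_sub_cancel_left]
    have h1 := qPoch_self_ne_zero hq (j + 1)
    have h2 := qPoch_self_ne_zero hq (d + 1)
    rw [qPoch_succ] at h1 h2
    rw [qPoch_succ q q (j + (d + 1)), qPoch_succ q q j, qPoch_succ q q d]
    obtain ⟨h3, h4⟩ := mul_ne_zero_iff.1 h1
    obtain ⟨h5, h6⟩ := mul_ne_zero_iff.1 h2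
    field_simp
    ring

/-- The finite `q`-binomial theorem, in homogeneous form. -/
lemma prod_add_mul_pow_eq_sum_qbinom {q : ℂ} (hq : ‖q‖ < 1) (x y : ℂ) (n : ℕ) :
    ∏ k ∈ Finset.range n, (x + y * q ^ k) =
      ∑ j ∈ Finset.range (n + 1), qbinom q n j * q ^ j.choose 2 * y ^ j * x ^ (n - j) := by
  induction n with
  | zero => simp [qbinom_zero hq]
  | succ n ih =>
    have hx : ∑ j ∈ Finset.range (n + 1), qbinom q n j * q ^ j.choose 2 * y ^ j * x ^ (n - j) * x =
        ∑ j ∈ Finset.range (n + 2),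
          qbinom q n j * q ^ j.choose 2 * y ^ j * x ^ (n + 1 - j) := by
      rw [Finset.sum_range_succ _ (n + 1), qbinom_eq_zero q n.lt_succ_self]
      simp only [zero_mul, add_zero]
      refine Finset.sum_congr rfl fun j hj => ?_
      rw [Nat.succ_sub (Nat.lt_succ_iff.1 (Finset.mem_range.1 hj)), pow_succ, mul_assoc _ _ x]
    rw [Finset.prod_range_succ, ih, mul_add, Finset.sum_mul, Finset.sum_mul, hx,
      Finset.sum_range_succ' _ (n + 1), Finset.sum_range_succ' _ (n + 1), add_right_comm,
      ← Finset.sum_add_distrib, qbinom_zero hq, qbinom_zero hq]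
    congr 1
    refine Finset.sum_congr rfl fun j hj => ?_
    have hj' : j ≤ n := Nat.lt_succ_iff.1 (Finset.mem_range.1 hj)
    have hc : (j + 1).choose 2 = j + j.choose 2 := by simp [Nat.choose_succ_succ' j 1]
    rw [qbinom_succ_succ hq hj', Nat.succ_sub_succ, hc]
    obtain ⟨d, rfl⟩ := Nat.exists_eq_add_of_le hj'
    rw [Nat.add_sub_cancel_left]
    ring

lemma choose_two_exponent_symm (s i j : ℕ) :
    (s + i + 1).choose 2 + (s + i + 1) * j + j.choose 2 + i.choose 2 =
      (j + i + 1).choose 2 + (j + i + 1) * s + s.choose 2 + i.choose 2 := by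
  have : (((s + i + 1).choose 2 + (s + i + 1) * j + j.choose 2 + i.choose 2 : ℕ) : ℚ) =
      ((j + i + 1).choose 2 + (j + i + 1) * s + s.choose 2 + i.choose 2 : ℕ) := by
    push_cast [Nat.cast_choose_two]
    ring
  exact_mod_cast this

lemma qbinom_mul_mul {q : ℂ} (hq : ‖q‖ < 1) (s i j t : ℕ) :
    qbinom q (s + i + (j + t)) (s + i) * qbinom q (s + i) i * qbinom q (j + t) j =
      qPoch q q (s + i + (j + t)) /
        (qPoch q q s * qPoch q q i * qPoch q q j * qPoch q q t) := by
  rw [qbinom_add, add_comm s i, qbinom_add, qbinom_add]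
  have h1 := qPoch_self_ne_zero hq (i + s)
  have h2 := qPoch_self_ne_zero hq (j + t)
  have h3 := qPoch_self_ne_zero hq s
  have h4 := qPoch_self_ne_zero hq i
  have h5 := qPoch_self_ne_zero hq j
  have h6 := qPoch_self_ne_zero hq t
  field_simp

/-- Clearing denominators in the finite Srivastava sum gives a polynomial symmetric in `a, b`. -/
noncomputable def clearedSum (n : ℕ) (q a b lam : ℂ) : ℂ :=
  ∑ m ∈ Finset.range (n + 1), qbinom q n m * (∏ k ∈ Finset.range m, (a + lam * q ^ k)) *
    q ^ (m + 1).choose 2 * qPoch (-(b * q) * q ^ m) q (n - m)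

lemma clearedSum_eq_sum {q : ℂ} (hq : ‖q‖ < 1) (n : ℕ) (a b lam : ℂ) :
    clearedSum n q a b lam =
      ∑ m ∈ Finset.range (n + 1), ∑ i ∈ Finset.range (m + 1), ∑ j ∈ Finset.range (n - m + 1),
        qbinom q n m * qbinom q m i * qbinom q (n - m) j *
          q ^ ((m + 1).choose 2 + (m + 1) * j + j.choose 2 + i.choose 2) *
          (lam ^ i * a ^ (m - i) * b ^ j) := by
  refine Finset.sum_congr rfl fun m _ => ?_
  have h : qPoch (-(b * q) * q ^ m) q (n - m) =
      ∏ k ∈ Finset.range (n - m), (1 + b * q ^ (m + 1) * q ^ k) :=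
    Finset.prod_congr rfl fun k _ => by ring
  rw [h, prod_add_mul_pow_eq_sum_qbinom hq a, Finset.mul_sum, Finset.sum_mul, Finset.sum_mul]
  refine Finset.sum_congr rfl fun i _ => ?_
  rw [prod_add_mul_pow_eq_sum_qbinom hq 1, Finset.mul_sum]
  refine Finset.sum_congr rfl fun j _ => ?_
  rw [one_pow, mul_pow, ← pow_mul]
  ring

lemma clearedSum_comm {q : ℂ} (hq : ‖q‖ < 1) (n : ℕ) (a b lam : ℂ) :
    clearedSum n q a b lam = clearedSum n q b a lam := by
  rw [clearedSum_eq_sum hq, clearedSum_eq_sum hq]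
  simp only [Finset.sum_sigma']
  refine Finset.sum_nbij' (fun p => ⟨p.2.2 + p.2.1, p.2.1, p.1 - p.2.1⟩)
    (fun p => ⟨p.2.2 + p.2.1, p.2.1, p.1 - p.2.1⟩) ?_ ?_ ?_ ?_ ?_
  · rintro ⟨m, i, j⟩ h
    simp only [Finset.mem_sigma, Finset.mem_range] at h ⊢
    omega
  · rintro ⟨m, i, j⟩ h
    simp only [Finset.mem_sigma, Finset.mem_range] at h ⊢
    omega
  · rintro ⟨m, i, j⟩ h
    simp only [Finset.mem_sigma, Finset.mem_range] at h ⊢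
    rw [Nat.add_sub_cancel, Nat.sub_add_cancel (by omega)]
  · rintro ⟨m, i, j⟩ h
    simp only [Finset.mem_sigma, Finset.mem_range] at h ⊢
    rw [Nat.add_sub_cancel, Nat.sub_add_cancel (by omega)]
  · rintro ⟨m, i, j⟩ h
    simp only [Finset.mem_sigma, Finset.mem_range] at h ⊢
    obtain ⟨s, rfl⟩ := Nat.exists_eq_add_of_le' (show i ≤ m by omega)
    obtain ⟨t, rfl⟩ := Nat.exists_eq_add_of_le (show s + i + j ≤ n by omega)
    rw [Nat.add_sub_cancel, Nat.add_sub_cancel, choose_two_exponent_symm s i j,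
      show s + i + j + t - (s + i) = j + t by omega,
      show s + i + j + t - (j + i) = s + t by omega]
    have h1 := qbinom_mul_mul hq s i j t
    have h2 := qbinom_mul_mul hq j i s t
    rw [show s + i + (j + t) = s + i + j + t by ring] at h1
    rw [show j + i + (s + t) = s + i + j + t by ring] at h2
    rw [h1, h2]
    ring

lemma qPoch_mul_sum_eq_clearedSum {n : ℕ} {q a b : ℂ} (lam : ℂ) (ha : a ≠ 0)
    (hB : ∀ k : ℕ, 1 ≤ k → k ≤ n → 1 + b * q ^ k ≠ 0) :
    qPoch (-(b * q)) q n * ∑ m ∈ Finset.range (n + 1),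
        qbinom q n m * (qPoch (-lam / a) q m * a ^ m * q ^ (m * (m + 1) / 2)
          / qPoch (-(b * q)) q m) = clearedSum n q a b lam := by
  rw [clearedSum, Finset.mul_sum]
  refine Finset.sum_congr rfl fun m hm => ?_
  have hm' : m ≤ n := Nat.lt_succ_iff.1 (Finset.mem_range.1 hm)
  have hne := qPoch_neg_mul_ne_zero hB hm'
  have hsplit := qPoch_add (-(b * q)) q m (n - m)
  rw [Nat.add_sub_cancel' hm'] at hsplit
  rw [hsplit, qPoch_div_mul_pow ha, Nat.choose_two_right, Nat.add_sub_cancel, mul_comm (m + 1) m]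
  field_simp

theorem finite_srivastava (n : ℕ) (q a b lam : ℂ) (hq0 : 0 < ‖q‖) (hq1 : ‖q‖ < 1)
    (ha : a ≠ 0) (hb : b ≠ 0)
    (hA : ∀ k : ℕ, 1 ≤ k → k ≤ n → 1 + a * q ^ k ≠ 0)
    (hB : ∀ k : ℕ, 1 ≤ k → k ≤ n → 1 + b * q ^ k ≠ 0) :
    ∑ m ∈ Finset.range (n + 1),
        qbinom q n m * (qPoch (-lam / a) q m * a ^ m * q ^ (m * (m + 1) / 2)
          / qPoch (-(b * q)) q m)
      = (qPoch (-(a * q)) q n / qPoch (-(b * q)) q n) *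
          ∑ m ∈ Finset.range (n + 1),
            qbinom q n m * (qPoch (-lam / b) q m * b ^ m * q ^ (m * (m + 1) / 2)
              / qPoch (-(a * q)) q m) := by
  have hne := qPoch_neg_mul_ne_zero hB le_rfl
  rw [div_mul_eq_mul_div, eq_div_iff hne, mul_comm, qPoch_mul_sum_eq_clearedSum lam ha hB,
    qPoch_mul_sum_eq_clearedSum lam hb hA, clearedSum_comm hq1]
end

section
/- For every integer ℓ ≥ 0 and every complex q with |q| < 1, the generating function of the number of generalized non-Rascoe partitions associated with ℓ satisfies ∑_{n=0}^{∞} b_ℓ(n) q^n = (-q;q)_∞ · σ_{2,ℓ}(q). -/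
open scoped BigOperators

/-- The infinite q-Pochhammer symbol `(a;q)_∞`. -/
noncomputable def qPochInf (a q : ℂ) : ℂ := ∏' k : ℕ, (1 - a * q ^ k)

/-- `bgen ℓ n` is the number of generalized non-Rascoe partitions of `n` associated with
`ℓ`: partitions of `n` into distinct parts such that (number of parts) + ℓ is not a part.
(For `n = 0` the empty partition counts, so `bgen ℓ 0 = 1`.) -/
noncomputable def bgen (ℓ n : ℕ) : ℕ :=
  Nat.card {p : Nat.Partition n // p.parts.Nodup ∧ Multiset.card p.parts + ℓ ∉ p.parts}

/-- The generalized rank parity function `σ_{2,ℓ}(q)`. -/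
noncomputable def sigma2l (ℓ : ℕ) (q : ℂ) : ℂ :=
  ∑' n : ℕ, (-1) ^ n * q ^ (n ^ 2 + ℓ * n) / qPoch (-q) q n

open Filter Topology

namespace NonRascoe

/-- A finite set `S` of naturals encodes the partition into the distinct parts `i + 1`, `i ∈ S`;
this is the set of those encoding a generalized non-Rascoe partition associated with `m`. -/
def nonRascoe (m : ℕ) : Set (Finset ℕ) := {S | ∀ i ∈ S, i + 1 ≠ S.card + m}

/-- `q` to the sum of the parts, when `S` encodes the partition with parts `i + n + 1`, `i ∈ S`. -/
noncomputable def weight (q : ℂ) (n : ℕ) (S : Finset ℕ) : ℂ := ∏ i ∈ S, q ^ (i + n + 1)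

/-- The generating function of the non-Rascoe sets, each part being shifted by `n`. -/
noncomputable def genFun (q : ℂ) (m n : ℕ) : ℂ := ∑' S : nonRascoe m, weight q n S

lemma card_add_notMem {m : ℕ} {T : Finset ℕ} (hT : T ∈ nonRascoe (m + 1)) :
    T.card + m ∉ T := fun h => hT _ h (by ring)

/-- Inserting the part `T.card + m` turns a non-Rascoe set into a set that is not non-Rascoe
for the previous index. -/
noncomputable def insertEquiv (m : ℕ) : nonRascoe (m + 1) ≃ ↥(nonRascoe m)ᶜ :=
  Equiv.ofBijective
    (fun T => ⟨insert (T.1.card + m) T.1, fun h => h (T.1.card + m) (Finset.mem_insert_self _ _) (by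
      rw [Finset.card_insert_of_notMem (card_add_notMem T.2)]; ring)⟩) (by
    constructor
    · rintro ⟨T, hT⟩ ⟨U, hU⟩ h
      have h : insert (T.card + m) T = insert (U.card + m) U := congrArg Subtype.val h
      have hc := congrArg Finset.card h
      rw [Finset.card_insert_of_notMem (card_add_notMem hT),
        Finset.card_insert_of_notMem (card_add_notMem hU)] at hc
      have hc : T.card = U.card := by omega
      have he := congrArg (Finset.erase · (T.card + m)) h
      simp only [Finset.erase_insert (card_add_notMem hT)] at he
      rw [hc, Finset.erase_insert (card_add_notMem hU)] at he
      exact Subtype.ext he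
    · rintro ⟨S, hS⟩
      have hS : ∃ i ∈ S, i + 1 = S.card + m := by
        simpa [nonRascoe] using hS
      obtain ⟨i, hi, him⟩ := hS
      have hc := Finset.card_erase_add_one hi
      have hi' : (S.erase i).card + m = i := by omega
      refine ⟨⟨S.erase i, fun j hj hjm => ?_⟩, Subtype.ext ?_⟩
      · have := Finset.ne_of_mem_erase hj
        omega
      · simp only [hi', Finset.insert_erase hi])

lemma weight_insertEquiv (q : ℂ) (m n : ℕ) (T : nonRascoe (m + 1)) :
    weight q n (insertEquiv m T) = q ^ (m + n + 1) * weight q (n + 1) T := by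
  change weight q n (insert (T.1.card + m) T.1) = _
  have h : weight q (n + 1) T = q ^ T.1.card * weight q n T := by
    simp only [weight]
    rw [← Finset.prod_const, ← Finset.prod_mul_distrib]
    exact Finset.prod_congr rfl fun i _ => by ring
  rw [h, weight, Finset.prod_insert (card_add_notMem T.2), ← weight]
  ring

variable {q : ℂ}

lemma summable_norm_part (hq : ‖q‖ < 1) (n : ℕ) : Summable fun i : ℕ => ‖q ^ (i + n + 1)‖ := by
  have := (summable_nat_add_iff (n + 1)).2 (summable_geometric_of_lt_one (norm_nonneg q) hq)
  simpa only [norm_pow, add_assoc] using this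

lemma summable_norm_weight (hq : ‖q‖ < 1) (n : ℕ) : Summable fun S => ‖weight q n S‖ := by
  simpa only [weight, norm_prod] using
    summable_finsetProd_of_summable_nonneg (fun _ => norm_nonneg _) (summable_norm_part hq n)

lemma summable_weight (hq : ‖q‖ < 1) (n : ℕ) : Summable (weight q n) :=
  (summable_norm_weight hq n).of_norm

lemma norm_weight_le (hq : ‖q‖ < 1) (n : ℕ) (S : Finset ℕ) : ‖weight q n S‖ ≤ ‖weight q 0 S‖ := by
  simp only [weight, norm_prod, norm_pow]
  exact Finset.prod_le_prod (fun _ _ => by positivity) fun i _ =>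
    pow_le_pow_of_le_one (norm_nonneg q) hq.le (by omega)

lemma norm_tsum_weight_le (hq : ‖q‖ < 1) (n : ℕ) :
    ‖∑' S, weight q n S‖ ≤ ∑' S, ‖weight q 0 S‖ :=
  (norm_tsum_le_tsum_norm (summable_norm_weight hq n)).trans
    ((summable_norm_weight hq n).tsum_mono (summable_norm_weight hq 0) (norm_weight_le hq n))

lemma norm_genFun_le (hq : ‖q‖ < 1) (m n : ℕ) : ‖genFun q m n‖ ≤ ∑' S, ‖weight q 0 S‖ :=
  ((norm_tsum_le_tsum_norm ((summable_norm_weight hq n).subtype _)).trans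
    ((summable_norm_weight hq n).tsum_subtype_le _ _ fun _ => norm_nonneg _)).trans
    ((summable_norm_weight hq n).tsum_mono (summable_norm_weight hq 0) (norm_weight_le hq n))

lemma genFun_add (hq : ‖q‖ < 1) (m n : ℕ) :
    genFun q m n + q ^ (m + n + 1) * genFun q (m + 1) (n + 1) = ∑' S, weight q n S := by
  rw [← (summable_weight hq n).tsum_subtype_add_tsum_subtype_compl (nonRascoe m), genFun, genFun,
    ← tsum_mul_left, ← (insertEquiv m).tsum_eq]
  simp only [weight_insertEquiv]

lemma sum_add_genFun (hq : ‖q‖ < 1) (ℓ N : ℕ) :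
    ∑ n ∈ Finset.range N, (-1) ^ n * q ^ (n ^ 2 + ℓ * n) * ∑' S, weight q n S +
      (-1) ^ N * q ^ (N ^ 2 + ℓ * N) * genFun q (ℓ + N) N = genFun q ℓ 0 := by
  induction N with
  | zero => simp
  | succ N ih =>
    rw [Finset.sum_range_succ, ← ih, ← genFun_add hq (ℓ + N) N, ← add_assoc ℓ N 1]
    ring

lemma norm_term_le (hq : ‖q‖ < 1) (ℓ n : ℕ) {x : ℂ} {C : ℝ} (hx : ‖x‖ ≤ C) :
    ‖(-1) ^ n * q ^ (n ^ 2 + ℓ * n) * x‖ ≤ ‖q‖ ^ n * C := by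
  simp only [norm_mul, norm_pow, norm_neg, norm_one, one_pow, one_mul]
  exact mul_le_mul (pow_le_pow_of_le_one (norm_nonneg q) hq.le (by nlinarith [Nat.zero_le (ℓ * n)]))
    hx (norm_nonneg _) (by positivity)

lemma hasSum_genFun (hq : ‖q‖ < 1) (ℓ : ℕ) :
    HasSum (fun n => (-1) ^ n * q ^ (n ^ 2 + ℓ * n) * ∑' S, weight q n S) (genFun q ℓ 0) := by
  have hgeom := summable_geometric_of_lt_one (norm_nonneg q) hq
  have hs : Summable fun n => (-1) ^ n * q ^ (n ^ 2 + ℓ * n) * ∑' S, weight q n S :=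
    (hgeom.mul_right _).of_norm_bounded fun n => norm_term_le hq ℓ n (norm_tsum_weight_le hq n)
  rw [hs.hasSum_iff_tendsto_nat]
  have hrem : Tendsto (fun N => (-1) ^ N * q ^ (N ^ 2 + ℓ * N) * genFun q (ℓ + N) N)
      atTop (𝓝 0) :=
    squeeze_zero_norm (fun N => norm_term_le hq ℓ N (norm_genFun_le hq (ℓ + N) N))
      (hgeom.mul_right _).tendsto_atTop_zero
  have := (tendsto_const_nhds (x := genFun q ℓ 0)).sub hrem
  rw [sub_zero] at this
  exact this.congr fun N => by rw [← sum_add_genFun hq ℓ N, add_sub_cancel_right]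

lemma qPoch_ne_zero (hq : ‖q‖ < 1) (n : ℕ) : qPoch (-q) q n ≠ 0 := by
  refine Finset.prod_ne_zero_iff.2 fun k _ h => ?_
  have h1 : q ^ (k + 1) = -1 := by linear_combination h
  have h2 : ‖q‖ ^ (k + 1) = 1 := by simpa using congrArg norm h1
  exact (pow_lt_one₀ (norm_nonneg q) hq k.succ_ne_zero).ne h2

lemma qPoch_mul_tsum_weight (hq : ‖q‖ < 1) (n : ℕ) :
    qPoch (-q) q n * ∑' S, weight q n S = qPochInf (-q) q := by
  have h : ∀ i : ℕ, 1 - -q * q ^ (i + n) = 1 + q ^ (i + n + 1) := fun i => by ring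
  have hm : Multipliable fun i : ℕ => 1 - -q * q ^ (i + n) := by
    simpa only [h] using multipliable_one_add_of_summable (summable_norm_part hq n)
  rw [qPochInf, ← Multipliable.prod_mul_tprod_nat_mul' (f := fun i => 1 - -q * q ^ i) hm, qPoch]
  simp only [h, weight, ← tprod_one_add (summable_weight hq n)]

lemma qPochInf_mul_sigma2l (hq : ‖q‖ < 1) (ℓ : ℕ) :
    qPochInf (-q) q * sigma2l ℓ q = genFun q ℓ 0 := by
  rw [sigma2l, ← tsum_mul_left, ← (hasSum_genFun hq ℓ).tsum_eq]
  refine tsum_congr fun n => ?_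
  rw [← qPoch_mul_tsum_weight hq n]
  field_simp [qPoch_ne_zero hq n]

/-- The size of the partition encoded by `S`. -/
def size (S : Finset ℕ) : ℕ := ∑ i ∈ S, (i + 1)

lemma weight_zero (S : Finset ℕ) : weight q 0 S = q ^ size S := by
  simp [weight, size, Finset.prod_pow_eq_pow_sum]

lemma card_nonRascoe_size (ℓ n : ℕ) :
    Nat.card {S : nonRascoe ℓ // size S = n} = bgen ℓ n := by
  have hinj : Function.Injective fun i : ℕ => i + 1 := add_left_injective 1
  refine Nat.card_eq_of_bijective (fun S => ⟨⟨S.1.1.val.map (· + 1), ?_, S.2⟩, ?_, ?_⟩) ⟨?_, ?_⟩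
  · simp only [Multiset.mem_map]
    rintro _ ⟨i, -, rfl⟩
    exact i.succ_pos
  · exact S.1.1.nodup.map hinj
  · simp only [Multiset.card_map, Multiset.mem_map, not_exists, not_and]
    exact S.1.2
  · rintro ⟨⟨S, hS⟩, hn⟩ ⟨⟨T, hT⟩, hn'⟩ h
    have h := congrArg (fun p => p.1.parts) h
    simpa using Multiset.map_injective hinj h
  · rintro ⟨⟨p, hpos, hsum⟩, hnd, hmem⟩
    have hp : (p.map (· - 1)).map (· + 1) = p := by
      rw [Multiset.map_map]
      conv_rhs => rw [← Multiset.map_id p]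
      exact Multiset.map_congr rfl fun i hi => Nat.succ_pred_eq_of_pos (hpos hi)
    refine ⟨⟨⟨⟨p.map (· - 1), ?_⟩, ?_⟩, ?_⟩, ?_⟩
    · exact Multiset.Nodup.of_map (· + 1) (hp.symm ▸ hnd)
    · intro i hi h
      refine hmem ?_
      have : i + 1 ∈ (p.map (· - 1)).map (· + 1) := Multiset.mem_map_of_mem _ hi
      rw [hp, h] at this
      simpa using this
    · change ((p.map (· - 1)).map (· + 1)).sum = n
      rw [hp, hsum]
    · exact Subtype.ext (Nat.Partition.ext hp)

lemma tsum_bgen (hq : ‖q‖ < 1) (ℓ : ℕ) : ∑' n : ℕ, (bgen ℓ n : ℂ) * q ^ n = genFun q ℓ 0 := by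
  have hs : Summable ((fun S : nonRascoe ℓ => weight q 0 S) ∘
      Equiv.sigmaFiberEquiv fun S : nonRascoe ℓ => size S) :=
    (Equiv.summable_iff _).2 ((summable_weight hq 0).subtype _)
  have h := hs.tsum_sigma
  simp only [Function.comp_def, Equiv.tsum_eq (Equiv.sigmaFiberEquiv _)
    fun S : nonRascoe ℓ => weight q 0 S] at h
  rw [genFun, h]
  refine tsum_congr fun n => ?_
  have hfib : ∀ S : {S : nonRascoe ℓ // size S = n}, weight q 0 S.1 = q ^ n :=
    fun S => by rw [weight_zero, S.2]
  simp only [Equiv.sigmaFiberEquiv_apply, hfib, tsum_const, nsmul_eq_mul, card_nonRascoe_size]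

end NonRascoe

theorem generalized_nonRascoe_gen_fun (ℓ : ℕ) (q : ℂ) (hq : ‖q‖ < 1) :
    ∑' n : ℕ, (bgen ℓ n : ℂ) * q ^ n = qPochInf (-q) q * sigma2l ℓ q := by
  rw [NonRascoe.tsum_bgen hq, NonRascoe.qPochInf_mul_sigma2l hq]
end

section
/- (i) For every integer n ≥ 0, b₁(n) is odd if and only if n = m(5m−3)/2 for some integer m ∈ ℤ. (ii) For every integer n ≥ 0, b₂(n) is odd if and only if n = m(5m+1)/2 − 1 for some integer m ∈ ℤ or n = m(5m−3)/2 − 1 for some integer m ∈ ℤ. -/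
open Finset Polynomial

/-- Sets of positive integers with sum `n`, i.e. partitions of `n` into distinct parts. -/
def distinctParts (n : ℕ) : Finset (Finset ℕ) :=
  {s ∈ (Icc 1 n).powerset | ∑ i ∈ s, i = n}

lemma mem_distinctParts {n : ℕ} {s : Finset ℕ} :
    s ∈ distinctParts n ↔ 0 ∉ s ∧ ∑ i ∈ s, i = n := by
  simp only [distinctParts, mem_filter, mem_powerset]
  refine and_congr_left fun h => ⟨fun hs h0 => by simpa using hs h0, fun h0 i hi => ?_⟩
  have h1 : i ≤ ∑ j ∈ s, j := single_le_sum (f := fun j => j) (fun _ _ => Nat.zero_le _) hi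
  have h2 : i ≠ 0 := fun h => h0 (h ▸ hi)
  simp only [mem_Icc]
  omega

/-- Distinct partitions of `n` having (number of parts) + `ℓ` as a part. -/
def rascoe (ℓ n : ℕ) : Finset (Finset ℕ) := {s ∈ distinctParts n | #s + ℓ ∈ s}

/-- Distinct partitions of `n` not having (number of parts) + `ℓ` as a part. -/
def nonRascoe (ℓ n : ℕ) : Finset (Finset ℕ) := {s ∈ distinctParts n | #s + ℓ ∉ s}

lemma mem_rascoe {ℓ n : ℕ} {s : Finset ℕ} :
    s ∈ rascoe ℓ n ↔ (0 ∉ s ∧ ∑ i ∈ s, i = n) ∧ #s + ℓ ∈ s := by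
  rw [rascoe, mem_filter, mem_distinctParts]

lemma mem_nonRascoe {ℓ n : ℕ} {s : Finset ℕ} :
    s ∈ nonRascoe ℓ n ↔ (0 ∉ s ∧ ∑ i ∈ s, i = n) ∧ #s + ℓ ∉ s := by
  rw [nonRascoe, mem_filter, mem_distinctParts]

lemma card_rascoe_add_card_nonRascoe (ℓ n : ℕ) :
    #(rascoe ℓ n) + #(nonRascoe ℓ n) = #(distinctParts n) :=
  card_filter_add_card_filter_not _

lemma bgen_eq_card_nonRascoe (ℓ n : ℕ) : bgen ℓ n = #(nonRascoe ℓ n) := by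
  classical
  rw [bgen, Nat.card_eq_fintype_card, Fintype.card_subtype]
  refine card_bij (fun p _ => p.parts.toFinset) ?_ ?_ ?_
  · intro p hp
    rw [mem_filter] at hp
    obtain ⟨-, hnd, hp⟩ := hp
    rw [mem_nonRascoe]
    refine ⟨⟨fun h => ?_, ?_⟩, ?_⟩
    · exact (p.parts_pos (Multiset.mem_toFinset.mp h)).ne' rfl
    · rw [Finset.sum, Multiset.toFinset_val, hnd.dedup]
      simpa using p.parts_sum
    · rwa [Multiset.toFinset_card_of_nodup hnd, Multiset.mem_toFinset]
  · intro p hp r hr h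
    simp only [mem_filter, mem_univ, true_and] at hp hr
    ext1
    have := congrArg Finset.val h
    simpa [hp.1.dedup, hr.1.dedup] using this
  · intro s hs
    rw [mem_nonRascoe] at hs
    obtain ⟨⟨h0, hsum⟩, hs⟩ := hs
    refine ⟨⟨s.val, fun {i} hi => Nat.pos_of_ne_zero fun h => h0 (h ▸ hi), ?_⟩, ?_, ?_⟩
    · rwa [Finset.sum, Multiset.map_id'] at hsum
    · simp only [mem_filter, mem_univ, true_and]
      exact ⟨s.nodup, by simpa using hs⟩
    · simp

lemma rascoe_eq_empty {ℓ n : ℕ} (h : n ≤ ℓ) : rascoe ℓ n = ∅ := by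
  refine eq_empty_of_forall_notMem fun s hs => ?_
  rw [mem_rascoe] at hs
  obtain ⟨⟨h0, hsum⟩, hs⟩ := hs
  have h1 : #s + ℓ ≤ ∑ j ∈ s, j :=
    single_le_sum (f := fun j => j) (fun _ _ => Nat.zero_le _) hs
  have h2 : 0 < #s := card_pos.mpr ⟨_, hs⟩
  omega

lemma sum_image_add_one (s : Finset ℕ) :
    ∑ i ∈ s.image (· + 1), i = ∑ i ∈ s, i + #s := by
  rw [sum_image (by simp)]
  simp [sum_add_distrib]

lemma image_sub_one_image_add_one (s : Finset ℕ) :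
    (s.image (· + 1)).image (· - 1) = s := by
  simp [image_image, Function.comp_def]

lemma image_add_one_image_sub_one {s : Finset ℕ} (h0 : 0 ∉ s) :
    (s.image (· - 1)).image (· + 1) = s := by
  rw [image_image]
  conv_rhs => rw [← image_id (s := s)]
  refine image_congr fun i hi => ?_
  have : i ≠ 0 := fun h => h0 (h ▸ hi)
  simp only [Function.comp_apply, id]
  omega

/-- Removing the part `#s + ℓ` and adding one to every other part. -/
lemma card_rascoe_eq (ℓ n : ℕ) :
    #(rascoe ℓ (n + ℓ + 1)) = #{s ∈ nonRascoe (ℓ + 2) n | 1 ∉ s} := by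
  refine card_nbij' (fun s => (s.erase (#s + ℓ)).image (· + 1))
    (fun t => insert (#t + 1 + ℓ) (t.image (· - 1))) ?_ ?_ ?_ ?_
  · intro s hs
    rw [mem_coe, mem_rascoe] at hs
    obtain ⟨⟨h0, hsum⟩, hs⟩ := hs
    have hc : #(s.erase (#s + ℓ)) + 1 = #s := card_erase_add_one hs
    have hsum' := add_sum_erase s (fun i => i) hs
    have hc' : #((s.erase (#s + ℓ)).image (· + 1)) = #(s.erase (#s + ℓ)) :=
      card_image_of_injective _ (add_left_injective 1)
    rw [mem_coe, mem_filter, mem_nonRascoe, sum_image_add_one, hc']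
    refine ⟨⟨⟨by simp, by omega⟩, ?_⟩, by simp [h0]⟩
    simp only [mem_image, not_exists, not_and]
    intro i hi h
    have : i ≠ #s + ℓ := ne_of_mem_erase hi
    omega
  · intro t ht
    rw [mem_coe, mem_filter, mem_nonRascoe] at ht
    obtain ⟨⟨⟨h0, hsum⟩, ht⟩, h1⟩ := ht
    have himg := image_add_one_image_sub_one h0
    have hc : #(t.image (· - 1)) = #t := by
      conv_rhs => rw [← himg, card_image_of_injective _ (add_left_injective 1)]
    have hs : ∑ i ∈ t.image (· - 1), i + #t = n := by
      rw [← hsum]; conv_rhs => rw [← himg]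
      rw [sum_image_add_one, hc]
    have hn : #t + 1 + ℓ ∉ t.image (· - 1) := fun h => ht <| by
      have h' := mem_image_of_mem (· + 1) h
      rw [himg] at h'
      convert h' using 1
      omega
    rw [mem_coe, mem_rascoe, card_insert_of_notMem hn, sum_insert hn, hc]
    refine ⟨⟨?_, by omega⟩, mem_insert_self _ _⟩
    rw [mem_insert, not_or]
    refine ⟨by omega, fun h => h1 ?_⟩
    rw [← himg]; exact mem_image.mpr ⟨_, h, rfl⟩
  · intro s hs
    rw [mem_coe, mem_rascoe] at hs
    obtain ⟨⟨h0, hsum⟩, hs⟩ := hs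
    have hc : #(s.erase (#s + ℓ)) + 1 = #s := card_erase_add_one hs
    have hc' : #((s.erase (#s + ℓ)).image (· + 1)) = #(s.erase (#s + ℓ)) :=
      card_image_of_injective _ (add_left_injective 1)
    simp only [hc', hc]
    rw [image_sub_one_image_add_one, insert_erase hs]
  · intro t ht
    rw [mem_coe, mem_filter, mem_nonRascoe] at ht
    obtain ⟨⟨⟨h0, hsum⟩, ht⟩, h1⟩ := ht
    have himg := image_add_one_image_sub_one h0
    have hc : #(t.image (· - 1)) = #t := by
      conv_rhs => rw [← himg, card_image_of_injective _ (add_left_injective 1)]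
    have hn : #t + 1 + ℓ ∉ t.image (· - 1) := fun h => ht <| by
      have h' := mem_image_of_mem (· + 1) h
      rw [himg] at h'
      convert h' using 1
      omega
    simp only [card_insert_of_notMem hn, hc]
    rw [erase_insert hn, himg]

lemma card_nonRascoe_filter_one_mem (ℓ n : ℕ) :
    #{s ∈ nonRascoe (ℓ + 1) (n + 1) | 1 ∈ s} = #{s ∈ nonRascoe (ℓ + 2) n | 1 ∉ s} := by
  refine card_nbij' (fun s => s.erase 1) (fun t => insert 1 t) ?_ ?_ ?_ ?_
  · intro s hs
    rw [mem_coe, mem_filter, mem_nonRascoe] at hs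
    obtain ⟨⟨⟨h0, hsum⟩, hs⟩, h1⟩ := hs
    have hc := card_erase_add_one h1
    have hsum' := add_sum_erase s (fun i => i) h1
    simp only [mem_coe, mem_filter, mem_nonRascoe]
    refine ⟨⟨⟨fun h => h0 (mem_of_mem_erase h), by omega⟩, fun h => hs ?_⟩, by simp⟩
    have := mem_of_mem_erase h
    rwa [← hc, add_right_comm, add_assoc, add_assoc]
  · intro t ht
    rw [mem_coe, mem_filter, mem_nonRascoe] at ht
    obtain ⟨⟨⟨h0, hsum⟩, ht⟩, h1⟩ := ht
    rw [mem_coe, mem_filter, mem_nonRascoe, sum_insert h1, card_insert_of_notMem h1,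
      mem_insert, mem_insert, not_or, not_or]
    refine ⟨⟨⟨⟨by omega, h0⟩, by omega⟩, by omega, fun h => ht ?_⟩, mem_insert_self _ _⟩
    rwa [add_right_comm, add_assoc, add_assoc] at h
  · intro s hs
    exact insert_erase (mem_filter.mp (mem_coe.mp hs)).2
  · intro t ht
    exact erase_insert (mem_filter.mp (mem_coe.mp ht)).2

lemma card_rascoe_add_card_rascoe (ℓ n : ℕ) :
    #(rascoe ℓ (n + ℓ + 1)) + #(rascoe (ℓ + 1) (n + ℓ + 1)) = #(nonRascoe (ℓ + 2) n) := by
  rw [← card_filter_add_card_filter_not (s := nonRascoe (ℓ + 2) n) (fun s => 1 ∈ s),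
    card_rascoe_eq, add_comm]
  congr 1
  cases n with
  | zero =>
    rw [rascoe_eq_empty (by omega), card_empty, eq_comm, card_eq_zero, filter_eq_empty_iff]
    intro s hs h1
    have hsum := (mem_nonRascoe.mp hs).1.2
    have : 1 ≤ ∑ j ∈ s, j := single_le_sum (f := fun j => j) (fun _ _ => Nat.zero_le _) h1
    omega
  | succ n =>
    rw [card_nonRascoe_filter_one_mem (ℓ + 1) n, ← card_rascoe_eq (ℓ + 1) n]
    congr 2
    omega

lemma bgen_of_le {ℓ n : ℕ} (h : n ≤ ℓ) : bgen ℓ n = #(distinctParts n) := by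
  rw [bgen_eq_card_nonRascoe, ← card_rascoe_add_card_nonRascoe ℓ n, rascoe_eq_empty h]
  simp

lemma bgen_rec (ℓ n : ℕ) :
    (bgen ℓ (n + ℓ + 1) : ZMod 2) = bgen (ℓ + 1) (n + ℓ + 1) + bgen (ℓ + 2) n := by
  simp only [bgen_eq_card_nonRascoe]
  rw [← card_rascoe_add_card_rascoe]
  have h1 := congrArg (Nat.cast : ℕ → ZMod 2) (card_rascoe_add_card_nonRascoe ℓ (n + ℓ + 1))
  have h2 := congrArg (Nat.cast : ℕ → ZMod 2)
    (card_rascoe_add_card_nonRascoe (ℓ + 1) (n + ℓ + 1))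
  have h3 : (2 : ZMod 2) = 0 := rfl
  push_cast at h1 h2 ⊢
  linear_combination h1 - h2 - (#(rascoe ℓ (n + ℓ + 1)) : ZMod 2) * h3

/-- The product `(1 + X ^ (n + 1)) ⋯ (1 + X ^ (n + ℓ))`. -/
noncomputable def shiftedProd (ℓ n : ℕ) : (ZMod 2)[X] := ∏ i ∈ range ℓ, (1 + X ^ (n + 1 + i))

lemma shiftedProd_succ (ℓ n : ℕ) :
    shiftedProd (ℓ + 1) n = shiftedProd ℓ n * (1 + X ^ (n + 1 + ℓ)) :=
  prod_range_succ _ _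

lemma shiftedProd_succ' (ℓ n : ℕ) :
    shiftedProd (ℓ + 1) n = shiftedProd ℓ (n + 1) * (1 + X ^ (n + 1)) := by
  rw [shiftedProd, prod_range_succ', shiftedProd]
  congr 1
  exact prod_congr rfl fun i _ => by congr 2; omega

lemma coeff_shiftedProd_zero {ℓ n : ℕ} (h : n ≤ ℓ) :
    (shiftedProd ℓ 0).coeff n = (#(distinctParts n) : ZMod 2) := by
  have h1 : shiftedProd ℓ 0 = ∏ i ∈ Icc 1 ℓ, (1 + X ^ i) := by
    rw [shiftedProd, ← Finset.Ico_add_one_right_eq_Icc, prod_Ico_eq_prod_range]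
    simp
  rw [h1, prod_one_add, finsetSum_coeff]
  simp only [prod_pow_eq_pow_sum _ (fun i => i), coeff_X_pow]
  rw [sum_boole]
  congr 2
  ext s
  rw [mem_distinctParts, mem_filter, mem_powerset]
  refine ⟨fun ⟨hs, hn⟩ => ⟨fun h0 => by simpa using hs h0, hn.symm⟩, fun hs => ?_⟩
  have := (mem_filter.mp (mem_distinctParts.mpr hs)).1
  exact ⟨(mem_powerset.mp this).trans (Icc_subset_Icc_right h), hs.2.symm⟩

/-- The numbers `n (5 n + 1) / 2`. -/
def fivePent (n : ℕ) : ℕ := n * (5 * n + 1) / 2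

lemma two_mul_fivePent (n : ℕ) : 2 * fivePent n = n * (5 * n + 1) := by
  refine Nat.two_mul_div_two_of_even ?_
  rcases Nat.even_or_odd n with h | h
  · exact h.mul_right _
  · exact Even.mul_left (by obtain ⟨k, rfl⟩ := h; exact ⟨5 * k + 3, by ring⟩) _

lemma fivePent_succ (n : ℕ) : fivePent (n + 1) = fivePent n + 5 * n + 3 := by
  have h1 := two_mul_fivePent n
  have h2 := two_mul_fivePent (n + 1)
  nlinarith

lemma le_fivePent (n : ℕ) : n ≤ fivePent n := by
  have := two_mul_fivePent n
  nlinarith [Nat.le_mul_self n]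

/-- Partial sum of Andrews' series `(q)_∞ J_{2,2}(q ^ ℓ)`, reduced modulo 2. -/
noncomputable def andrewsTwo (ℓ N : ℕ) : (ZMod 2)[X] :=
  ∑ n ∈ range N, X ^ (2 * n * ℓ + fivePent n) * shiftedProd ℓ n * (1 + X ^ (2 * ℓ + 4 * n + 2))

/-- Partial sum of Andrews' series `(q)_∞ J_{2,1}(q ^ ℓ)`, reduced modulo 2. -/
noncomputable def andrewsOne (ℓ N : ℕ) : (ZMod 2)[X] :=
  ∑ n ∈ range N, X ^ (2 * n * ℓ + fivePent n + n) * shiftedProd ℓ n * (1 + X ^ (ℓ + 2 * n + 1))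

lemma andrewsOne_add (ℓ N : ℕ) :
    andrewsOne ℓ N + X ^ (2 * N * ℓ + fivePent N + N) * shiftedProd ℓ N * (1 + X ^ N)
      = andrewsTwo (ℓ + 1) N := by
  have h2 : (2 : (ZMod 2)[X]) = 0 := CharTwo.two_eq_zero
  induction N with
  | zero =>
    simp only [andrewsOne, andrewsTwo, range_zero, sum_empty, pow_zero]
    linear_combination (X ^ (2 * 0 * ℓ + fivePent 0 + 0) * shiftedProd ℓ 0) * h2
  | succ N ih =>
    have h3 := (shiftedProd_succ ℓ N).symm.trans (shiftedProd_succ' ℓ N)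
    rw [andrewsTwo, sum_range_succ, ← andrewsTwo, ← ih, andrewsOne, sum_range_succ, ← andrewsOne,
      fivePent_succ, shiftedProd_succ]
    linear_combination (-X ^ (2 * (N + 1) * ℓ + (fivePent N + 5 * N + 3) + (N + 1))) * h3
      - X ^ (2 * N * ℓ + fivePent N + 2 * N) * shiftedProd ℓ N * h2

lemma andrewsTwo_add (ℓ N : ℕ) :
    andrewsTwo ℓ N + X ^ (2 * N * ℓ + fivePent N) * shiftedProd ℓ N * (1 + X ^ N)
      = andrewsOne ℓ N + X ^ (ℓ + 1) * andrewsOne (ℓ + 1) N := by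
  have h2 : (2 : (ZMod 2)[X]) = 0 := CharTwo.two_eq_zero
  induction N with
  | zero =>
    simp only [andrewsOne, andrewsTwo, range_zero, sum_empty, pow_zero]
    linear_combination (X ^ (2 * 0 * ℓ + fivePent 0) * shiftedProd ℓ 0) * h2
  | succ N ih =>
    have h3 := (shiftedProd_succ ℓ N).symm.trans (shiftedProd_succ' ℓ N)
    rw [andrewsTwo, andrewsOne, andrewsOne, sum_range_succ, sum_range_succ, sum_range_succ,
      ← andrewsTwo, ← andrewsOne, ← andrewsOne, fivePent_succ, shiftedProd_succ]
    linear_combination ih - X ^ (2 * (N + 1) * ℓ + (fivePent N + 5 * N + 3)) * h3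
      - (X ^ (2 * N * ℓ + fivePent N + N) + X ^ (2 * N * ℓ + fivePent N + ℓ + 3 * N + 1))
        * shiftedProd ℓ N * h2

lemma coeff_X_pow_mul_mul_of_lt {R : Type*} [CommSemiring R] {n k : ℕ} (h : n < k) (p r : R[X]) :
    (X ^ k * p * r).coeff n = 0 := by
  rw [mul_assoc, coeff_X_pow_mul', if_neg (by omega)]

lemma coeff_andrewsOne {ℓ n N : ℕ} (h : n < N) :
    (andrewsOne ℓ N).coeff n = (andrewsTwo (ℓ + 1) N).coeff n := by
  have := le_fivePent N
  rw [← andrewsOne_add, coeff_add, coeff_X_pow_mul_mul_of_lt (by omega), add_zero]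

lemma coeff_andrewsTwo {ℓ n N : ℕ} (h : n < N) :
    (andrewsTwo ℓ N).coeff n
      = (andrewsTwo (ℓ + 1) N).coeff n + (X ^ (ℓ + 1) * andrewsTwo (ℓ + 2) N).coeff n := by
  have := le_fivePent N
  have h1 := congrArg (coeff · n) (andrewsTwo_add ℓ N)
  simp only [coeff_add] at h1
  rw [coeff_X_pow_mul_mul_of_lt (by omega), add_zero, coeff_andrewsOne h] at h1
  rw [h1, coeff_X_pow_mul', coeff_X_pow_mul']
  split_ifs with h2
  · rw [coeff_andrewsOne (by omega)]
  · rfl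

lemma coeff_andrewsTwo_of_le {ℓ n N : ℕ} (h : n < N) (hn : n ≤ ℓ) :
    (andrewsTwo ℓ N).coeff n = (#(distinctParts n) : ZMod 2) := by
  obtain ⟨N, rfl⟩ : ∃ M, N = M + 1 := ⟨N - 1, by omega⟩
  rw [andrewsTwo, sum_range_succ', coeff_add, finsetSum_coeff, sum_eq_zero, zero_add,
    ← coeff_shiftedProd_zero hn, mul_add, coeff_add, mul_one,
    coeff_mul_X_pow', if_neg (by omega)]
  · simp [fivePent]
  · intro m _
    refine coeff_X_pow_mul_mul_of_lt ?_ _ _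
    rw [fivePent_succ]
    nlinarith [Nat.zero_le (m * ℓ)]

lemma bgen_eq_coeff {n N : ℕ} (h : n < N) (ℓ : ℕ) :
    (bgen ℓ n : ZMod 2) = (andrewsTwo ℓ N).coeff n := by
  induction n using Nat.strong_induction_on generalizing ℓ with
  | _ n ih =>
    rcases le_total n ℓ with hn | hn
    · rw [bgen_of_le hn, coeff_andrewsTwo_of_le h hn]
    · induction hn using Nat.decreasingInduction with
      | self => rw [bgen_of_le le_rfl, coeff_andrewsTwo_of_le h le_rfl]
      | of_succ k hk ih' =>
        obtain ⟨m, rfl⟩ : ∃ m, n = m + k + 1 := ⟨n - k - 1, by omega⟩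
        have hm : m + k + 1 - (k + 1) = m := by omega
        have hk' : k + 1 ≤ m + k + 1 := by omega
        rw [bgen_rec, ih', coeff_andrewsTwo (ℓ := k) h, ih m (by omega) (by omega), coeff_X_pow_mul',
          if_pos hk', hm]

lemma sum_range_ite_eq {f : ℕ → ℕ} (hf : StrictMono f) {n N : ℕ} (h : n < N)
    [Decidable (∃ m, n = f m)] :
    ∑ m ∈ range N, (if n = f m then (1 : ZMod 2) else 0) = if ∃ m, n = f m then 1 else 0 := by
  split_ifs with hm
  · obtain ⟨m, rfl⟩ := hm
    rw [sum_eq_single m]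
    · simp
    · intro k _ hk
      exact if_neg fun h => hk (hf.injective h.symm)
    · intro hm
      have := hf.le_apply (x := m)
      rw [mem_range] at hm
      omega
  · exact sum_eq_zero fun m _ => if_neg fun h => hm ⟨m, h⟩

lemma strictMono_fivePent : StrictMono fivePent :=
  strictMono_nat_of_lt_succ fun n => by rw [fivePent_succ]; omega

open Classical in
lemma bgen_zero (n : ℕ) :
    (bgen 0 n : ZMod 2) = (if ∃ m, n = fivePent m then 1 else 0)
      + if ∃ m, n = fivePent m + 4 * m + 2 then 1 else 0 := by
  have h1 : StrictMono fun m => fivePent m + 4 * m + 2 := fun a b h => by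
    have := strictMono_fivePent h
    dsimp only
    omega
  rw [bgen_eq_coeff n.lt_succ_self, ← sum_range_ite_eq strictMono_fivePent n.lt_succ_self,
    ← sum_range_ite_eq h1 n.lt_succ_self, ← sum_add_distrib, andrewsTwo, finsetSum_coeff]
  refine sum_congr rfl fun m _ => ?_
  rw [shiftedProd, range_zero, prod_empty, mul_one, mul_add, mul_one, ← pow_add, coeff_add,
    coeff_X_pow, coeff_X_pow]
  simp only [mul_zero, zero_add, add_assoc]

open Classical in
lemma bgen_one (n : ℕ) :
    (bgen 1 n : ZMod 2) = (if ∃ m, n = fivePent m + m then 1 else 0)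
      + if ∃ m, n = fivePent m + 3 * m + 1 then 1 else 0 := by
  have h1 : StrictMono fun m => fivePent m + m := strictMono_fivePent.add strictMono_id
  have h2 : StrictMono fun m => fivePent m + 3 * m + 1 := fun a b h => by
    have := strictMono_fivePent h
    dsimp only
    omega
  rw [bgen_eq_coeff n.lt_succ_self, ← coeff_andrewsOne (ℓ := 0) n.lt_succ_self,
    ← sum_range_ite_eq h1 n.lt_succ_self,
    ← sum_range_ite_eq h2 n.lt_succ_self, ← sum_add_distrib, andrewsOne, finsetSum_coeff]
  refine sum_congr rfl fun m _ => ?_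
  rw [shiftedProd, range_zero, prod_empty, mul_one, mul_add, mul_one, ← pow_add, coeff_add,
    coeff_X_pow, coeff_X_pow]
  have : fivePent m + m + (2 * m + 1) = fivePent m + 3 * m + 1 := by omega
  simp only [mul_zero, zero_add, this]

lemma exists_int_fivePent_iff (n : ℕ) :
    (∃ m : ℤ, 2 * (n : ℤ) = m * (5 * m + 1)) ↔
      (∃ m, n = fivePent m) ∨ ∃ m, n = fivePent m + 4 * m + 2 := by
  constructor
  · rintro ⟨m, hm⟩
    rcases m with m | m
    · left
      refine ⟨m, ?_⟩
      have h1 := two_mul_fivePent m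
      zify at h1 ⊢
      simp only [Int.ofNat_eq_natCast] at hm
      linarith
    · right
      refine ⟨m, ?_⟩
      have h1 := two_mul_fivePent m
      zify at h1 ⊢
      rw [Int.negSucc_eq] at hm
      linarith
  · rintro (⟨m, rfl⟩ | ⟨m, rfl⟩)
    · refine ⟨m, ?_⟩
      exact_mod_cast two_mul_fivePent m
    · refine ⟨-(m + 1), ?_⟩
      have h1 := two_mul_fivePent m
      zify at h1
      push_cast
      linarith

lemma exists_int_fivePent_add_iff (n : ℕ) :
    (∃ m : ℤ, 2 * (n : ℤ) = m * (5 * m - 3)) ↔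
      (∃ m, n = fivePent m + m) ∨ ∃ m, n = fivePent m + 3 * m + 1 := by
  constructor
  · rintro ⟨m, hm⟩
    obtain ⟨k, rfl | rfl⟩ : ∃ k : ℕ, m = -k ∨ m = k + 1 := by
      rcases le_or_gt m 0 with h | h
      · exact ⟨m.natAbs, by omega⟩
      · exact ⟨(m - 1).natAbs, by omega⟩
    · left
      refine ⟨k, ?_⟩
      have h1 := two_mul_fivePent k
      zify at h1 ⊢
      linarith
    · right
      refine ⟨k, ?_⟩
      have h1 := two_mul_fivePent k
      zify at h1 ⊢
      linarith
  · rintro (⟨m, rfl⟩ | ⟨m, rfl⟩)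
    · refine ⟨-m, ?_⟩
      have h1 := two_mul_fivePent m
      zify at h1
      push_cast
      linarith
    · refine ⟨m + 1, ?_⟩
      have h1 := two_mul_fivePent m
      zify at h1
      push_cast
      linarith

/-- Between consecutive values of `fivePent` the other three families interlace. -/
lemma fivePent_add_lt_of_lt {a b : ℕ} (h : a < b) : fivePent a + 4 * a + 2 < fivePent b := by
  have h1 := strictMono_fivePent.monotone (Nat.succ_le_of_lt h)
  rw [Nat.succ_eq_add_one, fivePent_succ] at h1
  omega

lemma eq_of_fivePent_add_eq {r s : ℕ → ℕ} (hr : ∀ a, r a ≤ 4 * a + 2)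
    (hs : ∀ a, s a ≤ 4 * a + 2) {a b : ℕ} (hab : fivePent a + r a = fivePent b + s b) : a = b := by
  rcases lt_trichotomy a b with h | h | h
  · have := fivePent_add_lt_of_lt h
    have := hr a
    omega
  · exact h
  · have := fivePent_add_lt_of_lt h
    have := hs b
    omega

theorem bgen_parity (n : ℕ) :
    (Odd (bgen 1 n) ↔ ∃ m : ℤ, 2 * (n : ℤ) = m * (5 * m - 3)) ∧
    (Odd (bgen 2 n) ↔
      (∃ m : ℤ, 2 * ((n : ℤ) + 1) = m * (5 * m + 1)) ∨
      (∃ m : ℤ, 2 * ((n : ℤ) + 1) = m * (5 * m - 3))) := by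
  classical
  constructor
  · rw [exists_int_fivePent_add_iff, ← ZMod.natCast_eq_one_iff_odd, bgen_one]
    have h : ¬((∃ m, n = fivePent m + m) ∧ ∃ m, n = fivePent m + 3 * m + 1) := by
      rintro ⟨⟨a, ha⟩, b, hb⟩
      have := eq_of_fivePent_add_eq (r := fun a => a) (s := fun b => 3 * b + 1) (by intro; omega)
        (by intro; omega) (ha.symm.trans hb)
      subst this
      omega
    split_ifs <;> simp_all
  · have e1 := exists_int_fivePent_iff (n + 1)
    have e2 := exists_int_fivePent_add_iff (n + 1)
    have h2 := bgen_rec 0 n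
    simp only [add_zero, zero_add] at h2
    have h3 : (bgen 2 n : ZMod 2) = bgen 0 (n + 1) + bgen 1 (n + 1) := by
      rw [h2, add_comm, ← add_assoc, CharTwo.add_self_eq_zero, zero_add]
    rw [Nat.cast_add, Nat.cast_one] at e1 e2
    rw [e1, e2, ← ZMod.natCast_eq_one_iff_odd, h3, bgen_zero, bgen_one]
    have key (r t : ℕ → ℕ) (hr : ∀ a, r a ≤ 4 * a + 2) (ht : ∀ a, t a ≤ 4 * a + 2)
        (hrt : ∀ a, r a = t a → a + r a = 0) :
        ¬((∃ m, n + 1 = fivePent m + r m) ∧ ∃ m, n + 1 = fivePent m + t m) := by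
      rintro ⟨⟨a, ha⟩, b, hb⟩
      have := eq_of_fivePent_add_eq hr ht (ha.symm.trans hb)
      subst this
      have := hrt a (by omega)
      obtain rfl : a = 0 := by omega
      simp only [fivePent] at ha
      omega
    have k1 := key (fun _ => 0) (fun m => 4 * m + 2) (by intro; omega) (by intro; omega)
      (by intro; omega)
    have k2 := key (fun _ => 0) (fun m => m) (by intro; omega) (by intro; omega) (by intro; omega)
    have k3 := key (fun _ => 0) (fun m => 3 * m + 1) (by intro; omega) (by intro; omega)
      (by intro; omega)
    have k4 := key (fun m => 4 * m + 2) (fun m => m) (by intro; omega) (by intro; omega)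
      (by intro; omega)
    have k5 := key (fun m => 4 * m + 2) (fun m => 3 * m + 1) (by intro; omega) (by intro; omega)
      (by intro; omega)
    have k6 := key (fun m => m) (fun m => 3 * m + 1) (by intro; omega) (by intro; omega)
      (by intro; omega)
    simp only [add_zero, ← add_assoc] at k1 k2 k3 k4 k5 k6
    clear key h2 h3 e1 e2
    generalize (∃ m, n + 1 = fivePent m) = p1 at *
    generalize (∃ m, n + 1 = fivePent m + 4 * m + 2) = p2 at *
    generalize (∃ m, n + 1 = fivePent m + m) = p3 at *
    generalize (∃ m, n + 1 = fivePent m + 3 * m + 1) = p4 at *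
    split_ifs <;> simp_all
end

section
/- Let c(N) denote the number of partitions of a positive integer N in which the number of parts is itself a part, and let e(N) denote the number of partitions of N in which the number of parts is not a part, with e(0) := 1. Then for every complex q with |q| < 1: ∑_{N=1}^{∞} c(N) q^N = q / (q²;q)_∞ and ∑_{N=0}^{∞} e(N) q^N = (1 − q + q²) / (q;q)_∞. -/
open scoped BigOperators

/-- `c N` is the number of (unrestricted) partitions of `N` in which the number of parts
is itself a part. -/
noncomputable def c (N : ℕ) : ℕ :=
  Nat.card {p : Nat.Partition N // Multiset.card p.parts ∈ p.parts}

/-- `e N` is the number of (unrestricted) partitions of `N` in which the number of parts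
is not a part.  (For `N = 0` the empty partition counts, so `e 0 = 1`.) -/
noncomputable def e (N : ℕ) : ℕ :=
  Nat.card {p : Nat.Partition N // Multiset.card p.parts ∉ p.parts}

open Filter Topology

/-- The number of partitions of `N` all of whose parts are at least `k`. -/
def cardPartsGE (k N : ℕ) : ℕ := (Nat.Partition.restricted N (k ≤ ·)).card

lemma cardPartsGE_eq_natCard (k N : ℕ) :
    cardPartsGE k N = Nat.card {p : N.Partition // ∀ i ∈ p.parts, k ≤ i} := by
  rw [Nat.card_eq_fintype_card, Fintype.card_subtype]
  rfl

lemma cardPartsGE_one (N : ℕ) : cardPartsGE 1 N = Nat.card N.Partition := by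
  rw [cardPartsGE_eq_natCard]
  exact Nat.card_congr (Equiv.subtypeUnivEquiv fun p i hi => p.parts_pos hi)

lemma cardPartsGE_zero_right (k : ℕ) : cardPartsGE k 0 = 1 := by
  rw [cardPartsGE_eq_natCard, Nat.card_eq_one_iff_unique]
  exact ⟨⟨fun p r => Subtype.ext (Subsingleton.elim _ _)⟩, ⟨⟨default, by simp⟩⟩⟩

lemma cardPartsGE_of_lt {k N : ℕ} (hN : N ≠ 0) (h : N < k) : cardPartsGE k N = 0 := by
  rw [cardPartsGE, Finset.card_eq_zero, Nat.Partition.restricted, Finset.filter_eq_empty_iff]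
  intro p _ hp
  have h0 : p.parts ≠ 0 := by
    intro h0
    have := p.parts_sum
    simp [h0] at this
    omega
  obtain ⟨i, hi⟩ := Multiset.exists_mem_of_ne_zero h0
  have := hp i hi
  have := Nat.Partition.le_of_mem_parts hi
  omega

lemma cardPartsGE_le_one (k N : ℕ) : cardPartsGE k N ≤ cardPartsGE 1 N :=
  Finset.card_le_card fun p hp => by
    simp only [Nat.Partition.restricted, Finset.mem_filter, Finset.mem_univ, true_and]
    exact fun i hi => p.parts_pos hi

/-- Split the partitions with parts at least `k` according to whether `k` is a part. -/
lemma cardPartsGE_add {k : ℕ} (hk : 1 ≤ k) (N : ℕ) :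
    cardPartsGE k (N + k) = cardPartsGE (k + 1) (N + k) + cardPartsGE k N := by
  have hcard : cardPartsGE k N =
      Nat.card {p : (N + k).Partition // k ∈ p.parts ∧ ∀ i ∈ p.parts, k ≤ i} := by
    obtain ⟨M, hM⟩ : ∃ M, M = N + k := ⟨_, rfl⟩
    obtain rfl : N = M - k := by omega
    rw [Nat.sub_add_cancel (by omega), cardPartsGE_eq_natCard]
    refine Nat.card_congr (Equiv.trans ?_ (Equiv.subtypeSubtypeEquivSubtypeInter
      (fun p : M.Partition => k ∈ p.parts) (fun p => ∀ i ∈ p.parts, k ≤ i)))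
    refine (Nat.Partition.partitionWithPartEquiv hk (by omega)).symm.subtypeEquiv fun p => ?_
    simp
  rw [hcard, Nat.card_eq_fintype_card, Fintype.card_subtype, cardPartsGE, cardPartsGE,
    ← Finset.card_union_of_disjoint]
  · congr 1
    ext p
    simp only [Nat.Partition.restricted, Finset.mem_union, Finset.mem_filter, Finset.mem_univ,
      true_and]
    grind
  · rw [Finset.disjoint_left]
    simp only [Nat.Partition.restricted, Finset.mem_filter, Finset.mem_univ, true_and]
    grind

lemma cardPartsGE_succ_of_lt {k N : ℕ} (h : N < k) : cardPartsGE (k + 1) N = cardPartsGE k N := by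
  rcases eq_or_ne N 0 with rfl | hN
  · simp [cardPartsGE_zero_right]
  · rw [cardPartsGE_of_lt hN h, cardPartsGE_of_lt hN (by omega)]

lemma sum_range_cardPartsGE_le {r : ℝ} (hr : 0 ≤ r) {k n : ℕ} (hk : 1 ≤ k) (hkn : k ≤ n) :
    (∑ N ∈ Finset.range n, (cardPartsGE k N : ℝ) * r ^ N) * (1 - r ^ k) ≤
      ∑ N ∈ Finset.range n, (cardPartsGE (k + 1) N : ℝ) * r ^ N := by
  obtain ⟨m, rfl⟩ := Nat.exists_eq_add_of_le hkn
  have h1 : ∑ N ∈ Finset.range (k + m), (cardPartsGE k N : ℝ) * r ^ N =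
      ∑ N ∈ Finset.range (k + m), (cardPartsGE (k + 1) N : ℝ) * r ^ N +
        r ^ k * ∑ N ∈ Finset.range m, (cardPartsGE k N : ℝ) * r ^ N := by
    rw [Finset.sum_range_add, Finset.sum_range_add, Finset.mul_sum, add_assoc,
      ← Finset.sum_add_distrib]
    congr 1
    · refine Finset.sum_congr rfl fun N hN => ?_
      rw [cardPartsGE_succ_of_lt (Finset.mem_range.1 hN)]
    · refine Finset.sum_congr rfl fun N _ => ?_
      rw [add_comm k N, cardPartsGE_add hk]
      push_cast
      ring
  have h2 : ∑ N ∈ Finset.range m, (cardPartsGE k N : ℝ) * r ^ N ≤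
      ∑ N ∈ Finset.range (k + m), (cardPartsGE k N : ℝ) * r ^ N :=
    Finset.sum_le_sum_of_subset_of_nonneg (Finset.range_mono (by omega))
      fun _ _ _ => by positivity
  have h3 := mul_le_mul_of_nonneg_left h2 (pow_nonneg hr k)
  linarith

lemma sum_range_cardPartsGE_mul_prod_le_one {r : ℝ} (hr : 0 ≤ r) (hr1 : r < 1) (n : ℕ) :
    (∑ N ∈ Finset.range (n + 1), (cardPartsGE 1 N : ℝ) * r ^ N) *
      ∏ i ∈ Finset.range n, (1 - r ^ (i + 1)) ≤ 1 := by
  have key : ∀ j ≤ n, (∑ N ∈ Finset.range (n + 1), (cardPartsGE 1 N : ℝ) * r ^ N) *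
      ∏ i ∈ Finset.range j, (1 - r ^ (i + 1)) ≤
      ∑ N ∈ Finset.range (n + 1), (cardPartsGE (j + 1) N : ℝ) * r ^ N := by
    intro j
    induction j with
    | zero => simp
    | succ j ih =>
      intro hj
      rw [Finset.prod_range_succ, ← mul_assoc]
      exact (mul_le_mul_of_nonneg_right (ih (by omega))
        (sub_nonneg.2 (pow_le_one₀ hr hr1.le))).trans
        (sum_range_cardPartsGE_le hr (by omega) (by omega))
  refine (key n le_rfl).trans_eq ?_
  rw [Finset.sum_eq_single_of_mem 0 (by simp)]
  · simp [cardPartsGE_zero_right]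
  · intro N hN hN0
    rw [cardPartsGE_of_lt hN0 (Finset.mem_range.1 hN)]
    simp

lemma exists_pos_le_prod_one_sub_pow {r : ℝ} (hr : 0 ≤ r) (hr1 : r < 1) :
    ∃ C > 0, ∀ n, C ≤ ∏ i ∈ Finset.range n, (1 - r ^ (i + 1)) := by
  have hpos : ∀ i : ℕ, 0 < 1 - r ^ (i + 1) := fun i =>
    sub_pos.2 (pow_lt_one₀ hr hr1 (by omega))
  have hs : Summable fun i : ℕ => -r ^ (i + 1) :=
    ((summable_nat_add_iff 1).2 (summable_geometric_of_lt_one hr hr1)).neg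
  have hm : Multipliable fun i : ℕ => 1 - r ^ (i + 1) := by
    simpa [sub_eq_add_neg] using multipliable_one_add_of_summable hs.norm
  have hne : ∏' i : ℕ, (1 - r ^ (i + 1)) ≠ 0 := by
    simpa [sub_eq_add_neg] using tprod_one_add_ne_zero_of_summable (f := fun i : ℕ => -r ^ (i + 1))
      (fun i => by simpa [sub_eq_add_neg] using (hpos i).ne') hs.norm
  have hlim := hm.tendsto_prod_tprod_nat
  have hanti : Antitone fun n => ∏ i ∈ Finset.range n, (1 - r ^ (i + 1)) :=
    antitone_nat_of_succ_le fun n => by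
      rw [Finset.prod_range_succ]
      exact mul_le_of_le_one_right (Finset.prod_nonneg fun i _ => (hpos i).le)
        (sub_le_self _ (by positivity))
  exact ⟨_, hne.symm.lt_of_le (ge_of_tendsto' hlim fun n =>
    Finset.prod_nonneg fun i _ => (hpos i).le), fun n => hanti.le_of_tendsto hlim n⟩

lemma summable_cardPartsGE_one {r : ℝ} (hr : 0 ≤ r) (hr1 : r < 1) :
    Summable fun N => (cardPartsGE 1 N : ℝ) * r ^ N := by
  obtain ⟨C, hC, hle⟩ := exists_pos_le_prod_one_sub_pow hr hr1
  have hnn : ∀ N, 0 ≤ (cardPartsGE 1 N : ℝ) * r ^ N := fun N => by positivity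
  refine summable_of_sum_range_le (c := 1 / C) hnn fun n => ?_
  calc _ ≤ ∑ N ∈ Finset.range (n + 1), (cardPartsGE 1 N : ℝ) * r ^ N :=
        Finset.sum_le_sum_of_subset_of_nonneg (Finset.range_mono (by omega)) fun _ _ _ => hnn _
    _ ≤ 1 / C := by
      rw [le_div_iff₀ hC]
      exact (mul_le_mul_of_nonneg_left (hle n) (Finset.sum_nonneg fun _ _ => hnn _)).trans
        (sum_range_cardPartsGE_mul_prod_le_one hr hr1 n)

lemma norm_cardPartsGE_mul_pow_le (q : ℂ) (k N : ℕ) :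
    ‖(cardPartsGE k N : ℂ) * q ^ N‖ ≤ (cardPartsGE 1 N : ℝ) * ‖q‖ ^ N := by
  rw [norm_mul, norm_pow, Complex.norm_natCast]
  gcongr
  exact cardPartsGE_le_one k N

lemma summable_cardPartsGE {q : ℂ} (hq : ‖q‖ < 1) (k : ℕ) :
    Summable fun N => (cardPartsGE k N : ℂ) * q ^ N :=
  .of_norm_bounded (summable_cardPartsGE_one (norm_nonneg q) hq) (norm_cardPartsGE_mul_pow_le q k)

lemma tsum_cardPartsGE_mul_one_sub_pow {q : ℂ} (hq : ‖q‖ < 1) {k : ℕ} (hk : 1 ≤ k) :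
    (∑' N, (cardPartsGE k N : ℂ) * q ^ N) * (1 - q ^ k) =
      ∑' N, (cardPartsGE (k + 1) N : ℂ) * q ^ N := by
  have hs := summable_cardPartsGE hq
  have h : ∑' N, (cardPartsGE k (N + k) : ℂ) * q ^ (N + k) =
      ∑' N, (cardPartsGE (k + 1) (N + k) : ℂ) * q ^ (N + k) +
        (∑' N, (cardPartsGE k N : ℂ) * q ^ N) * q ^ k := by
    rw [← tsum_mul_right, ← ((summable_nat_add_iff k).2 (hs (k + 1))).tsum_add
      ((hs k).mul_right (q ^ k))]
    refine tsum_congr fun N => ?_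
    rw [cardPartsGE_add hk]
    push_cast
    ring
  have h' : ∑ N ∈ Finset.range k, (cardPartsGE (k + 1) N : ℂ) * q ^ N =
      ∑ N ∈ Finset.range k, (cardPartsGE k N : ℂ) * q ^ N :=
    Finset.sum_congr rfl fun N hN => by rw [cardPartsGE_succ_of_lt (Finset.mem_range.1 hN)]
  have h1 := (hs k).sum_add_tsum_nat_add k
  have h2 := (hs (k + 1)).sum_add_tsum_nat_add k
  linear_combination h2 - h1 + h - h'

lemma tsum_cardPartsGE_mul_prod {q : ℂ} (hq : ‖q‖ < 1) {k : ℕ} (hk : 1 ≤ k) (n : ℕ) :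
    (∑' N, (cardPartsGE k N : ℂ) * q ^ N) * ∏ i ∈ Finset.range n, (1 - q ^ k * q ^ i) =
      ∑' N, (cardPartsGE (n + k) N : ℂ) * q ^ N := by
  induction n with
  | zero => simp
  | succ n ih =>
    rw [Finset.prod_range_succ, ← mul_assoc, ih, ← pow_add, add_comm k n,
      tsum_cardPartsGE_mul_one_sub_pow hq (by omega), add_right_comm]

lemma tendsto_tsum_cardPartsGE {q : ℂ} (hq : ‖q‖ < 1) :
    Tendsto (fun k => ∑' N, (cardPartsGE k N : ℂ) * q ^ N) atTop (𝓝 1) := by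
  have h : Tendsto (fun k => ∑' N, (cardPartsGE k N : ℂ) * q ^ N) atTop
      (𝓝 (∑' N : ℕ, if N = 0 then 1 else 0)) := by
    refine tendsto_tsum_of_dominated_convergence (summable_cardPartsGE_one (norm_nonneg q) hq)
      (fun N => ?_) (.of_forall fun k N => norm_cardPartsGE_mul_pow_le q k N)
    refine tendsto_const_nhds.congr' ?_
    filter_upwards [eventually_gt_atTop N] with k hk
    split_ifs with hN
    · simp [hN, cardPartsGE_zero_right]
    · simp [cardPartsGE_of_lt hN hk]
  simpa using h

/-- The generating function of partitions with parts at least `k` is `1 / (q ^ k; q)_∞`. -/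
lemma tsum_cardPartsGE {q : ℂ} (hq : ‖q‖ < 1) {k : ℕ} (hk : 1 ≤ k) :
    ∑' N, (cardPartsGE k N : ℂ) * q ^ N = 1 / qPochInf (q ^ k) q := by
  have hm : Multipliable fun i : ℕ => 1 - q ^ k * q ^ i := by
    have hs : Summable fun i : ℕ => -(q ^ k * q ^ i) :=
      ((summable_geometric_of_norm_lt_one hq).mul_left (q ^ k)).neg
    simpa [sub_eq_add_neg] using multipliable_one_add_of_summable hs.norm
  have h1 := hm.tendsto_prod_tprod_nat.const_mul (∑' N, (cardPartsGE k N : ℂ) * q ^ N)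
  simp_rw [tsum_cardPartsGE_mul_prod hq hk] at h1
  exact eq_one_div_of_mul_eq_one_left (tendsto_nhds_unique h1
    ((tendsto_add_atTop_iff_nat k).2 (tendsto_tsum_cardPartsGE hq)))

/-- Removing the part that equals the number of parts and adding one to every other part turns
partitions of `N + 1` containing their number of parts into partitions of `N` without ones. -/
def cardMemPartsEquiv (N : ℕ) :
    {p : (N + 1).Partition // Multiset.card p.parts ∈ p.parts} ≃
      {p : N.Partition // ∀ i ∈ p.parts, 2 ≤ i} where
  toFun p := ⟨⟨(p.1.parts.erase (Multiset.card p.1.parts)).map (· + 1), by simp, by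
      have h1 := congrArg Multiset.sum (Multiset.cons_erase p.2)
      have h2 := congrArg Multiset.card (Multiset.cons_erase p.2)
      rw [Multiset.sum_cons, p.1.parts_sum] at h1
      rw [Multiset.card_cons] at h2
      simp only [Multiset.sum_map_add, Multiset.map_id', Multiset.map_const',
        Multiset.sum_replicate, smul_eq_mul, mul_one]
      omega⟩, by
      intro i hi
      obtain ⟨j, hj, rfl⟩ := Multiset.mem_map.1 hi
      have := p.1.parts_pos (Multiset.mem_of_mem_erase hj)
      omega⟩
  invFun p := ⟨⟨(Multiset.card p.1.parts + 1) ::ₘ p.1.parts.map (· - 1), by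
      intro i hi
      rcases Multiset.mem_cons.1 hi with rfl | hi
      · omega
      · obtain ⟨j, hj, rfl⟩ := Multiset.mem_map.1 hi
        have := p.2 j hj
        omega, by
      have h : (p.1.parts.map fun i => i - 1 + 1).sum = N := by
        rw [Multiset.map_congr rfl fun i hi => Nat.sub_add_cancel (one_le_two.trans (p.2 i hi)),
          Multiset.map_id', p.1.parts_sum]
      simp only [Multiset.sum_map_add, Multiset.map_const',
        Multiset.sum_replicate, smul_eq_mul, mul_one] at h
      rw [Multiset.sum_cons]
      omega⟩, by simp⟩
  left_inv p := by
    refine Subtype.ext (Nat.Partition.ext ?_)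
    have h2 := congrArg Multiset.card (Multiset.cons_erase p.2)
    rw [Multiset.card_cons] at h2
    simp only [Multiset.card_map, Multiset.map_map, Function.comp_def, Nat.add_sub_cancel,
      Multiset.map_id', h2]
    exact Multiset.cons_erase p.2
  right_inv p := by
    refine Subtype.ext (Nat.Partition.ext ?_)
    simp only [Multiset.card_cons, Multiset.card_map, Multiset.erase_cons_head, Multiset.map_map,
      Function.comp_def]
    rw [Multiset.map_congr rfl fun i hi => Nat.sub_add_cancel (one_le_two.trans (p.2 i hi)),
      Multiset.map_id']

lemma c_succ (N : ℕ) : c (N + 1) = cardPartsGE 2 N := by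
  rw [cardPartsGE_eq_natCard]
  exact Nat.card_congr (cardMemPartsEquiv N)

lemma c_zero : c 0 = 0 := by
  simp [c]

lemma c_add_e (N : ℕ) : c N + e N = cardPartsGE 1 N := by
  classical
  rw [cardPartsGE_one, c, e, ← Nat.card_sum]
  exact Nat.card_congr (Equiv.sumCompl _)

theorem unrestricted_rascoe_gen_fun (q : ℂ) (hq : ‖q‖ < 1) :
    (∑' N : ℕ, (c (N + 1) : ℂ) * q ^ (N + 1) = q / qPochInf (q ^ 2) q) ∧
    (∑' N : ℕ, (e N : ℂ) * q ^ N = (1 - q + q ^ 2) / qPochInf q q) := by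
  have hc : ∀ N, (c (N + 1) : ℂ) * q ^ (N + 1) = q * ((cardPartsGE 2 N : ℂ) * q ^ N) := fun N => by
    rw [c_succ, pow_succ]
    ring
  have hcsum : ∑' N : ℕ, (c (N + 1) : ℂ) * q ^ (N + 1) = q / qPochInf (q ^ 2) q := by
    simp_rw [hc]
    rw [tsum_mul_left, tsum_cardPartsGE hq one_le_two, mul_one_div]
  refine ⟨hcsum, ?_⟩
  have hs : Summable fun N => (c N : ℂ) * q ^ N := by
    rw [← summable_nat_add_iff 1]
    simp_rw [hc]
    exact (summable_cardPartsGE hq 2).mul_left q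
  have he : ∀ N, (e N : ℂ) * q ^ N = (cardPartsGE 1 N : ℂ) * q ^ N - (c N : ℂ) * q ^ N :=
    fun N => by
      rw [← c_add_e]
      push_cast
      ring
  have h1 := tsum_cardPartsGE hq le_rfl
  have h2 := tsum_cardPartsGE hq one_le_two
  have h12 := tsum_cardPartsGE_mul_one_sub_pow hq le_rfl
  rw [one_add_one_eq_two, h1, h2, pow_one] at h12
  simp_rw [he]
  rw [(summable_cardPartsGE hq 1).tsum_sub hs, hs.tsum_eq_zero_add, hcsum, h1, c_zero, pow_one]
  simp only [div_eq_mul_inv] at h12 ⊢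
  linear_combination q * h12
end
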